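/- Let Γ be a group, F a field of characteristic zero, and let ρ₁, ρ₂ : Γ → GL_n(F) be two semisimple representations of Γ. Suppose that for some positive integer k the k-th powers of their characters agree, i.e. Trace(ρ₁(γ))^k = Trace(ρ₂(γ))^k for every γ ∈ Γ. Then ρ₁ and ρ₂ are potentially isomorphic: there exists a finite-index subgroup Γ' of Γ such that the restrictions of ρ₁ and ρ₂ to Γ' are equivalent, i.e. there exists g ∈ GL_n(F) with ρ₂(γ) = g ρ₁(γ) g⁻¹ for all γ ∈ Γ'. -/

import Mathlib

/-- A matrix representation `ρ : Γ →* GL n F` is semisimple if `Fⁿ` is a semisimple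
module over `F[Γ]`, i.e. every `Γ`-invariant subspace has a `Γ`-invariant complement. -/
def MatrixRep.IsSemisimple {Γ F : Type*} [Group Γ] [Field F] {n : ℕ}
    (ρ : Γ →* GL (Fin n) F) : Prop :=
  ∀ W : Submodule F (Fin n → F),
    (∀ γ : Γ, ∀ v ∈ W, (ρ γ : Matrix (Fin n) (Fin n) F).mulVec v ∈ W) →
    ∃ W' : Submodule F (Fin n → F),
      (∀ γ : Γ, ∀ v ∈ W', (ρ γ : Matrix (Fin n) (Fin n) F).mulVec v ∈ W') ∧ IsCompl W W'

/-- Right translation by `γ` as an algebra endomorphism of a translation-stable subalgebra of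
functions on a group. -/
def Subalgebra.rightTranslate {Γ F : Type*} [Group Γ] [Field F] (A : Subalgebra F (Γ → F))
    (hA : ∀ (γ : Γ), ∀ f ∈ A, (fun x ↦ f (x * γ)) ∈ A) (γ : Γ) : A →ₐ[F] A where
  toFun f := ⟨fun x ↦ f.1 (x * γ), hA γ f.1 f.2⟩
  map_one' := rfl
  map_mul' _ _ := rfl
  map_zero' := rfl
  map_add' _ _ := rfl
  commutes' _ := rfl

/-- If a Noetherian algebra of functions on a group is stable under right translations, then
there is a finite-index subgroup on which `g` vanishes whenever `f * g = 0` and `f 1 ≠ 0`. -/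
theorem exists_finiteIndex_forall_eq_zero_of_mul_eq_zero {Γ F : Type*} [Group Γ] [Field F]
    (A : Subalgebra F (Γ → F)) [IsNoetherianRing A]
    (hA : ∀ (γ : Γ), ∀ f ∈ A, (fun x ↦ f (x * γ)) ∈ A) :
    ∃ Γ' : Subgroup Γ, Γ'.FiniteIndex ∧ ∀ f ∈ A, ∀ g ∈ A, f * g = 0 → f 1 ≠ 0 →
      ∀ γ ∈ Γ', g γ = 0 := by
  let T := A.rightTranslate hA
  have T_mul (γ δ : Γ) (f : A) : T (γ * δ) f = T γ (T δ f) :=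
    Subtype.ext <| funext fun x ↦ congrArg f.1 (mul_assoc x γ δ).symm
  have T_one (f : A) : T 1 f = f := Subtype.ext <| funext fun x ↦ congrArg f.1 (mul_one x)
  have T_bij (γ : Γ) : Function.Bijective (T γ) :=
    Function.bijective_iff_has_inverse.mpr ⟨T γ⁻¹, fun f ↦ by rw [← T_mul, inv_mul_cancel, T_one],
      fun f ↦ by rw [← T_mul, mul_inv_cancel, T_one]⟩
  let _ : MulAction Γ (Ideal A) :=
    { smul := fun γ I ↦ I.comap (T γ⁻¹)
      one_smul := fun I ↦ Ideal.ext fun f ↦ by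
        change T 1⁻¹ f ∈ I ↔ f ∈ I
        rw [inv_one, T_one]
      mul_smul := fun γ δ I ↦ Ideal.ext fun f ↦ by
        change T (γ * δ)⁻¹ f ∈ I ↔ T δ⁻¹ (T γ⁻¹ f) ∈ I
        rw [mul_inv_rev, T_mul] }
  have mem_smul (γ : Γ) (I : Ideal A) (f : A) : f ∈ γ • I ↔ T γ⁻¹ f ∈ I := Iff.rfl
  let ev : A →+* F := (Pi.evalRingHom (fun _ : Γ ↦ F) 1).comp A.val.toRingHom
  have hprime : (RingHom.ker ev).IsPrime := RingHom.ker_isPrime ev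
  obtain ⟨P, hP, hPle⟩ := Ideal.exists_minimalPrimes_le (bot_le : ⊥ ≤ RingHom.ker ev)
  have hPprime : P.IsPrime := hP.1.1
  have horbit : (MulAction.orbit Γ P).Finite := by
    refine (minimalPrimes.finite_of_isNoetherianRing A).subset ?_
    rintro _ ⟨γ, rfl⟩
    have h := Ideal.comap_minimalPrimes_eq_of_surjective (f := (T γ⁻¹ : A →+* A))
      (T_bij γ⁻¹).2 ⊥
    have hbot : (⊥ : Ideal A).comap (T γ⁻¹ : A →+* A) = ⊥ :=
      (RingHom.injective_iff_ker_eq_bot _).mp (T_bij γ⁻¹).1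
    rw [hbot] at h
    change P.comap (T γ⁻¹ : A →+* A) ∈ (⊥ : Ideal A).minimalPrimes
    rw [h]
    exact ⟨P, hP, rfl⟩
  refine ⟨MulAction.stabilizer Γ P, ⟨?_⟩, fun f hf g hg hfg hf1 γ hγ ↦ ?_⟩
  · rw [MulAction.index_stabilizer]
    exact ((Set.ncard_pos horbit).mpr (MulAction.nonempty_orbit P)).ne'
  · have hmem : (⟨g, hg⟩ : A) ∈ P := by
      refine (hPprime.mem_or_mem (x := ⟨f, hf⟩) (y := ⟨g, hg⟩) ?_).resolve_left
        fun h ↦ hf1 (hPle h)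
      rw [show (⟨f, hf⟩ * ⟨g, hg⟩ : A) = 0 from Subtype.ext hfg]
      exact P.zero_mem
    rw [← MulAction.mem_stabilizer_iff.mp (inv_mem hγ), mem_smul, inv_inv] at hmem
    have h : g (1 * γ) = 0 := hPle hmem
    rwa [one_mul] at h

/-- The algebra of functions generated by the matrix coefficients of two representations. -/
def matrixCoeffAlgebra {Γ F : Type*} [Group Γ] [Field F] {n : ℕ} (ρ₁ ρ₂ : Γ →* GL (Fin n) F) :
    Subalgebra F (Γ → F) :=
  Algebra.adjoin F
    (Set.range (fun (p : Fin n × Fin n) (γ : Γ) ↦ (ρ₁ γ : Matrix (Fin n) (Fin n) F) p.1 p.2) ∪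
      Set.range (fun (p : Fin n × Fin n) (γ : Γ) ↦ (ρ₂ γ : Matrix (Fin n) (Fin n) F) p.1 p.2))

theorem matrixCoeffAlgebra_translate_mem {Γ F : Type*} [Group Γ] [Field F] {n : ℕ}
    (ρ₁ ρ₂ : Γ →* GL (Fin n) F) (γ : Γ) (f : Γ → F) (hf : f ∈ matrixCoeffAlgebra ρ₁ ρ₂) :
    (fun x ↦ f (x * γ)) ∈ matrixCoeffAlgebra ρ₁ ρ₂ := by
  have key (ρ : Γ →* GL (Fin n) F)
      (hρ : ∀ i j, (fun x ↦ (ρ x : Matrix (Fin n) (Fin n) F) i j) ∈ matrixCoeffAlgebra ρ₁ ρ₂)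
      (i j : Fin n) : (fun x ↦ (ρ (x * γ) : Matrix (Fin n) (Fin n) F) i j) ∈
        matrixCoeffAlgebra ρ₁ ρ₂ := by
    have : (fun x ↦ (ρ (x * γ) : Matrix (Fin n) (Fin n) F) i j) =
        ∑ l, (ρ γ : Matrix (Fin n) (Fin n) F) l j •
          (fun x ↦ (ρ x : Matrix (Fin n) (Fin n) F) i l) := by
      funext x
      simp [Matrix.mul_apply, Finset.sum_apply, mul_comm]
    rw [this]
    exact sum_mem fun l _ ↦ Subalgebra.smul_mem _ (hρ i l) _
  refine Algebra.adjoin_induction (p := fun f _ ↦ (fun x ↦ f (x * γ)) ∈ matrixCoeffAlgebra ρ₁ ρ₂)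
    ?_ ?_ ?_ ?_ hf
  · rintro _ (⟨p, rfl⟩ | ⟨p, rfl⟩)
    · exact key ρ₁ (fun i j ↦ Algebra.subset_adjoin (.inl ⟨(i, j), rfl⟩)) p.1 p.2
    · exact key ρ₂ (fun i j ↦ Algebra.subset_adjoin (.inr ⟨(i, j), rfl⟩)) p.1 p.2
  · exact fun r ↦ (matrixCoeffAlgebra ρ₁ ρ₂).algebraMap_mem r
  · exact fun _ _ _ _ h₁ h₂ ↦ add_mem h₁ h₂
  · exact fun _ _ _ _ h₁ h₂ ↦ mul_mem h₁ h₂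

instance {Γ F : Type*} [Group Γ] [Field F] {n : ℕ} (ρ₁ ρ₂ : Γ →* GL (Fin n) F) :
    IsNoetherianRing (matrixCoeffAlgebra ρ₁ ρ₂) :=
  haveI : Algebra.FiniteType F (matrixCoeffAlgebra ρ₁ ρ₂) :=
    .adjoin_of_finite ((Set.finite_range _).union (Set.finite_range _))
  Algebra.FiniteType.isNoetherianRing F _

/-- If the `k`-th powers of two characters agree, then the characters agree on a finite-index
subgroup. -/
theorem exists_finiteIndex_trace_eq {Γ F : Type*} [Group Γ] [Field F] [CharZero F] {n : ℕ}
    [NeZero n] (ρ₁ ρ₂ : Γ →* GL (Fin n) F) {k : ℕ} (hk : 0 < k)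
    (hchar : ∀ γ : Γ, (ρ₁ γ : Matrix (Fin n) (Fin n) F).trace ^ k =
      (ρ₂ γ : Matrix (Fin n) (Fin n) F).trace ^ k) :
    ∃ Γ' : Subgroup Γ, Γ'.FiniteIndex ∧ ∀ γ ∈ Γ',
      (ρ₁ γ : Matrix (Fin n) (Fin n) F).trace = (ρ₂ γ : Matrix (Fin n) (Fin n) F).trace := by
  obtain ⟨Γ', hΓ', h⟩ := exists_finiteIndex_forall_eq_zero_of_mul_eq_zero
    (matrixCoeffAlgebra ρ₁ ρ₂) (matrixCoeffAlgebra_translate_mem ρ₁ ρ₂)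
  let t₁ : Γ → F := fun γ ↦ (ρ₁ γ : Matrix (Fin n) (Fin n) F).trace
  let t₂ : Γ → F := fun γ ↦ (ρ₂ γ : Matrix (Fin n) (Fin n) F).trace
  have ht₁ : t₁ ∈ matrixCoeffAlgebra ρ₁ ρ₂ := by
    have : t₁ = ∑ i, fun γ ↦ (ρ₁ γ : Matrix (Fin n) (Fin n) F) i i := by
      funext γ
      simp [t₁, Matrix.trace]
    exact this ▸ sum_mem fun i _ ↦ Algebra.subset_adjoin (.inl ⟨(i, i), rfl⟩)
  have ht₂ : t₂ ∈ matrixCoeffAlgebra ρ₁ ρ₂ := by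
    have : t₂ = ∑ i, fun γ ↦ (ρ₂ γ : Matrix (Fin n) (Fin n) F) i i := by
      funext γ
      simp [t₂, Matrix.trace]
    exact this ▸ sum_mem fun i _ ↦ Algebra.subset_adjoin (.inr ⟨(i, i), rfl⟩)
  refine ⟨Γ', hΓ', fun γ hγ ↦ sub_eq_zero.mp <|
    h (∑ i ∈ Finset.range k, t₁ ^ i * t₂ ^ (k - 1 - i))
      (sum_mem fun i _ ↦ mul_mem (pow_mem ht₁ _) (pow_mem ht₂ _)) (t₁ - t₂) (sub_mem ht₁ ht₂)
      ?_ ?_ γ hγ⟩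
  · rw [(Commute.all t₁ t₂).geom_sum₂_mul, sub_eq_zero]
    exact funext hchar
  · have : ∀ i ∈ Finset.range k, (n : F) ^ i * (n : F) ^ (k - 1 - i) = (n : F) ^ (k - 1) := by
      intro i hi
      rw [← pow_add]
      congr 1
      have := Finset.mem_range.mp hi
      omega
    simp [t₁, t₂, Finset.sum_apply, Finset.sum_congr rfl this, hk.ne', NeZero.ne n]

/-- Over a semisimple module, every fully invariant submodule has a fully invariant complement. -/
theorem Submodule.IsFullyInvariant.exists_isFullyInvariant_isCompl {R M : Type*}
    [Ring R] [AddCommGroup M] [Module R M] [IsSemisimpleModule R M] {I : Submodule R M} (hI : I.IsFullyInvariant) :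
    ∃ J : Submodule R M, J.IsFullyInvariant ∧ IsCompl I J := by
  have : ComplementedLattice (fullyInvariantSubmodule R M) :=
    (OrderIso.setIsotypicComponents (R := R) (M := M)).complementedLattice_iff.mp inferInstance
  obtain ⟨J, hJ⟩ := ComplementedLattice.exists_isCompl (⟨I, hI⟩ : fullyInvariantSubmodule R M)
  refine ⟨J, J.2, disjoint_iff.mpr ?_, codisjoint_iff.mpr ?_⟩
  · exact congrArg Subtype.val (disjoint_iff.mp hJ.1)
  · exact congrArg Subtype.val (codisjoint_iff.mp hJ.2)

open Module in
/-- By the density theorem, the projection onto a fully invariant submodule along a fully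
invariant complement is the action of a ring element. -/
theorem IsSemisimpleModule.exists_smul_eq_of_isFullyInvariant {R M : Type*} [Ring R]
    [AddCommGroup M] [Module R M] [IsSemisimpleModule R M] [Module.Finite (End R M) M]
    {I : Submodule R M} (hI : I.IsFullyInvariant) :
    ∃ r : R, (∀ m : M, r • m ∈ I) ∧ ∀ m ∈ I, r • m = m := by
  obtain ⟨J, hJ, hIJ⟩ := hI.exists_isFullyInvariant_isCompl
  let p : M →ₗ[R] M := I.projection J hIJ
  have hp (m : M) : m = p m + (m - p m) ∧ p m ∈ I ∧ m - p m ∈ J := by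
    refine ⟨by abel, Submodule.projection_apply_mem _ _, ?_⟩
    rw [← Submodule.ker_projection hIJ, LinearMap.mem_ker, map_sub, sub_eq_zero]
    exact (Submodule.projection_apply_left hIJ ⟨_, Submodule.projection_apply_mem hIJ m⟩).symm
  have hpI (m : M) (hm : m ∈ I) : p m = m := Submodule.projection_apply_left hIJ ⟨m, hm⟩
  have hpJ (m : M) (hm : m ∈ J) : p m = 0 := by
    rw [← LinearMap.mem_ker, Submodule.ker_projection hIJ]
    exact hm
  let q : End (End R M) M :=
    { toFun := p
      map_add' := map_add p
      map_smul' := fun f m ↦ by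
        change p (f m) = f (p m)
        conv_lhs => rw [(hp m).1, map_add, map_add]
        rw [hpI _ (hI f (hp m).2.1), hpJ _ (hJ f (hp m).2.2), add_zero] }
  obtain ⟨r, hr⟩ := Module.Finite.toModuleEnd_moduleEnd_surjective (R := R) (M := M) q
  have hr' (m : M) : r • m = p m := congrArg (fun f : End (End R M) M ↦ f m) hr
  exact ⟨r, fun m ↦ hr' m ▸ (hp m).2.1, fun m hm ↦ (hr' m).trans (hpI m hm)⟩

section Trace

variable {R F : Type*} [Field F] [Ring R] [Algebra F R]

theorem trace_lsmul_congr {V W : Type*} [AddCommGroup V] [Module F V] [Module R V]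
    [IsScalarTower F R V] [AddCommGroup W] [Module F W] [Module R W] [IsScalarTower F R W]
    (e : V ≃ₗ[R] W) (r : R) :
    LinearMap.trace F V (Algebra.lsmul F F V r) = LinearMap.trace F W (Algebra.lsmul F F W r) := by
  rw [← LinearMap.trace_conj' _ (e.restrictScalars F)]
  congr 1
  ext w
  simp [LinearEquiv.conj_apply]

theorem trace_lsmul_prod {V W : Type*} [AddCommGroup V] [Module F V] [Module R V]
    [IsScalarTower F R V] [AddCommGroup W] [Module F W] [Module R W] [IsScalarTower F R W]
    [FiniteDimensional F V] [FiniteDimensional F W] (r : R) :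
    LinearMap.trace F (V × W) (Algebra.lsmul F F (V × W) r) =
      LinearMap.trace F V (Algebra.lsmul F F V r) +
        LinearMap.trace F W (Algebra.lsmul F F W r) := by
  rw [← LinearMap.trace_prodMap']
  rfl

/-- A simple submodule of `V` embeds in `W` if `V` and `W` have equal traces. -/
theorem exists_linearEquiv_of_trace_eq [CharZero F] {V W : Type*} [AddCommGroup V] [Module F V]
    [Module R V] [IsScalarTower F R V] [AddCommGroup W] [Module F W] [Module R W]
    [IsScalarTower F R W] [FiniteDimensional F V] [FiniteDimensional F W]
    [IsSemisimpleModule R V] [IsSemisimpleModule R W]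
    (h : ∀ r : R, LinearMap.trace F V (Algebra.lsmul F F V r) =
      LinearMap.trace F W (Algebra.lsmul F F W r))
    (S : Submodule R V) [IsSimpleModule R S] : ∃ m : Submodule R W, Nonempty (m ≃ₗ[R] S) := by
  by_contra! hS
  have hW : isotypicComponent R W S = ⊥ := by
    rw [isotypicComponent, sSup_eq_bot]
    exact fun m hm ↦ absurd hm (not_nonempty_iff.mpr (hS m))
  have : IsSemisimpleModule R (V × W) := by
    have := IsSemisimpleModule.range (LinearMap.inl R V W)
    have := IsSemisimpleModule.range (LinearMap.inr R V W)
    have hsup := IsSemisimpleModule.sup (R := R) ‹IsSemisimpleModule R (LinearMap.inl R V W).range›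
      ‹IsSemisimpleModule R (LinearMap.inr R V W).range›
    rw [LinearMap.sup_range_inl_inr] at hsup
    exact .congr Submodule.topEquiv.symm
  have : Module.Finite (Module.End R (V × W)) (V × W) :=
    Module.Finite.of_restrictScalars_finite F _ _
  obtain ⟨r, hr, hr'⟩ := IsSemisimpleModule.exists_smul_eq_of_isFullyInvariant
    (Submodule.IsFullyInvariant.isotypicComponent R (V × W) S)
  have hrW : Algebra.lsmul F F W r = 0 := by
    ext w
    have := LinearMap.le_comap_isotypicComponent S (LinearMap.snd R V W) (hr (0, w))
    rw [hW] at this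
    simpa using this
  have hidem : IsIdempotentElem (Algebra.lsmul F F V r) := by
    ext v
    exact congrArg Prod.fst (hr' _ (hr (v, 0)))
  have hzero := (LinearMap.IsIdempotentElem.trace_eq_zero_iff hidem).mp
    (by rw [h r, hrW, map_zero])
  obtain ⟨s, hs⟩ := @exists_ne S (IsSimpleModule.nontrivial R S) 0
  have hsI := LinearMap.le_comap_isotypicComponent S (LinearMap.inl R V W)
    (S.le_isotypicComponent s.2)
  have h1 : r • (s : V) = s := congrArg Prod.fst (hr' _ hsI)
  have h2 : r • (s : V) = 0 := congrArg (fun f : Module.End F V ↦ f s) hzero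
  exact hs (Subtype.ext (h1.symm.trans h2))

/-- Over a field of characteristic zero, finite-dimensional semisimple modules over an algebra
are determined by their traces. -/
theorem IsSemisimpleModule.nonempty_linearEquiv_of_trace_eq [CharZero F] {V W : Type*}
    [AddCommGroup V] [Module F V]
    [Module R V] [IsScalarTower F R V] [AddCommGroup W] [Module F W] [Module R W]
    [IsScalarTower F R W] [FiniteDimensional F V] [FiniteDimensional F W]
    [IsSemisimpleModule R V] [IsSemisimpleModule R W]
    (h : ∀ r : R, LinearMap.trace F V (Algebra.lsmul F F V r) =
      LinearMap.trace F W (Algebra.lsmul F F W r)) : Nonempty (V ≃ₗ[R] W) := by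
  induction hd : Module.finrank F V using Nat.strong_induction_on generalizing V W with
  | _ d ih =>
  rcases subsingleton_or_nontrivial V with hV | hV
  · have h1 := h 1
    rw [map_one (Algebra.lsmul F F V), map_one (Algebra.lsmul F F W), LinearMap.trace_one,
      LinearMap.trace_one, Nat.cast_inj, Module.finrank_zero_of_subsingleton, eq_comm,
      Module.finrank_zero_iff] at h1
    exact ⟨0⟩
  · obtain ⟨S, hS⟩ := IsSemisimpleModule.exists_simple_submodule R V
    obtain ⟨m, ⟨e⟩⟩ := exists_linearEquiv_of_trace_eq h S
    obtain ⟨V', hV'⟩ := exists_isCompl S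
    obtain ⟨W', hW'⟩ := exists_isCompl m
    have : FiniteDimensional F S := inferInstanceAs (FiniteDimensional F (S.restrictScalars F))
    have : FiniteDimensional F V' := inferInstanceAs (FiniteDimensional F (V'.restrictScalars F))
    have : FiniteDimensional F m := inferInstanceAs (FiniteDimensional F (m.restrictScalars F))
    have : FiniteDimensional F W' := inferInstanceAs (FiniteDimensional F (W'.restrictScalars F))
    let eV := S.prodEquivOfIsCompl V' hV'
    let eW := m.prodEquivOfIsCompl W' hW'
    have hlt : Module.finrank F V' < d := by
      have hSpos : 0 < Module.finrank F S :=
        Module.finrank_pos_iff.mpr (IsSimpleModule.nontrivial R S)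
      have := (eV.restrictScalars F).finrank_eq
      rw [Module.finrank_prod] at this
      omega
    obtain ⟨e'⟩ := ih _ hlt (V := V') (W := W') (fun r ↦ by
      have hr := h r
      rwa [← trace_lsmul_congr eV, ← trace_lsmul_congr eW, trace_lsmul_prod, trace_lsmul_prod,
        trace_lsmul_congr e, add_right_inj] at hr) rfl
    exact ⟨eV.symm.trans ((e.symm.prodCongr e').trans eW)⟩

end Trace

open scoped MonoidAlgebra

section Clifford

variable {Γ F V : Type*} [Group Γ] [Field F] [AddCommGroup V] [Module F V]

/-- Translation by a group element of the subrepresentations of a normal subgroup. -/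
def Subrepresentation.conjOrderIso (ρ : Representation F Γ V) (N : Subgroup Γ) [hN : N.Normal]
    (γ : Γ) : Subrepresentation (ρ.comp N.subtype) ≃o Subrepresentation (ρ.comp N.subtype) where
  toFun σ := ⟨σ.toSubmodule.comap (ρ γ⁻¹), fun g v hv ↦ by
    have h := σ.apply_mem_toSubmodule ⟨γ⁻¹ * g * γ⁻¹⁻¹, hN.conj_mem g g.2 γ⁻¹⟩ hv
    simpa [← Module.End.mul_apply, ← map_mul] using h⟩
  invFun σ := ⟨σ.toSubmodule.comap (ρ γ), fun g v hv ↦ by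
    have h := σ.apply_mem_toSubmodule ⟨γ * g * γ⁻¹, hN.conj_mem g g.2 γ⟩ hv
    simpa [← Module.End.mul_apply, ← map_mul] using h⟩
  left_inv σ := by
    ext v
    simp [← Module.End.mul_apply, ← map_mul]
  right_inv σ := by
    ext v
    simp [← Module.End.mul_apply, ← map_mul]
  map_rel_iff' {σ τ} := by
    refine ⟨fun h v hv ↦ ?_, fun h v hv ↦ h hv⟩
    have := @h (ρ γ v) (by
      change ρ γ⁻¹ (ρ γ v) ∈ σ
      simpa [← Module.End.mul_apply, ← map_mul] using hv)
    change ρ γ⁻¹ (ρ γ v) ∈ τ at this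
    simpa [← Module.End.mul_apply, ← map_mul] using this

/-- Clifford's theorem: the restriction of a finite-dimensional semisimple representation to a
normal subgroup is semisimple. -/
theorem Representation.isSemisimpleModule_comp_subtype [FiniteDimensional F V]
    (ρ : Representation F Γ V) (N : Subgroup Γ) [hN : N.Normal]
    (h : ρ.IsSemisimpleRepresentation) :
    IsSemisimpleModule F[N] (Representation.asModule (ρ.comp N.subtype)) := by
  let ρN : Representation F N V := ρ.comp N.subtype
  let E : Subrepresentation ρN ≃o Submodule F[N] ρN.asModule :=
    Subrepresentation.subrepresentationSubmoduleOrderIso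
  have hart : IsArtinian F[N] ρN.asModule := isArtinian_of_tower F inferInstance
  let soc : Submodule F[N] ρN.asModule := sSup {m | IsSimpleModule F[N] m}
  let e (γ : Γ) : Submodule F[N] ρN.asModule ≃o Submodule F[N] ρN.asModule :=
    (E.symm.trans (Subrepresentation.conjOrderIso ρ N γ)).trans E
  have hsoc (γ : Γ) : soc ≤ e γ soc := by
    rw [OrderIso.map_sSup]
    refine sSup_le fun m hm ↦ ?_
    have hm' : IsSimpleModule F[N] ((e γ).symm m) := by
      rw [isSimpleModule_iff_isAtom, OrderIso.isAtom_iff, ← isSimpleModule_iff_isAtom]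
      exact hm
    exact le_iSup₂_of_le ((e γ).symm m) hm' ((e γ).apply_symm_apply m).ge
  let socΓ : Subrepresentation ρ := ⟨(E.symm soc).toSubmodule, fun γ v hv ↦ by
    have := hsoc γ⁻¹ hv
    change ρ γ⁻¹⁻¹ v ∈ E.symm soc at this
    rwa [inv_inv] at this⟩
  obtain ⟨C, hC⟩ := exists_isCompl socΓ
  let CN : Submodule F[N] ρN.asModule := E ⟨C.toSubmodule, fun g ↦ C.apply_mem_toSubmodule g⟩
  have hdisj : Disjoint soc CN := by
    rw [Submodule.disjoint_def]
    intro v hv hv'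
    have : v ∈ socΓ ⊓ C := ⟨hv, hv'⟩
    rw [hC.inf_eq_bot] at this
    exact this
  have hbot : CN = ⊥ := by
    refine (eq_bot_or_exists_atom_le CN).resolve_right fun ⟨m, hm, hle⟩ ↦ hm.1 ?_
    have hsimple : IsSimpleModule F[N] m := isSimpleModule_iff_isAtom.mpr hm
    have hle' : m ≤ soc := le_sSup hsimple
    exact (hdisj.mono_left hle').eq_bot_of_le hle
  refine .of_sSup_simples_eq_top (top_le_iff.mp fun v _ ↦ ?_)
  have hv : v ∈ socΓ ⊔ C := by
    rw [hC.sup_eq_top]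
    trivial
  obtain ⟨x, hx, y, hy, rfl⟩ := Submodule.mem_sup.mp hv
  have hy0 : y = 0 := by
    have : y ∈ CN := hy
    rwa [hbot] at this
  rw [hy0, add_zero]
  exact hx

end Clifford

/-- The linear representation on `Fⁿ` attached to a matrix representation. -/
def MatrixRep.toRepresentation {Γ F : Type*} [Group Γ] [Field F] {n : ℕ}
    (ρ : Γ →* GL (Fin n) F) : Representation F Γ (Fin n → F) :=
  (Matrix.toLinAlgEquiv' : _ ≃ₐ[F] _).toMonoidHom.comp ((Units.coeHom _).comp ρ)

theorem MatrixRep.IsSemisimple.isSemisimpleRepresentation {Γ F : Type*} [Group Γ] [Field F]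
    {n : ℕ} {ρ : Γ →* GL (Fin n) F} (h : MatrixRep.IsSemisimple ρ) :
    (MatrixRep.toRepresentation ρ).IsSemisimpleRepresentation where
  exists_isCompl σ := by
    obtain ⟨W', hW', hc⟩ := h σ.toSubmodule fun γ v hv ↦ σ.apply_mem_toSubmodule γ hv
    refine ⟨⟨W', fun γ v hv ↦ hW' γ v hv⟩, disjoint_iff.mpr ?_, codisjoint_iff.mpr ?_⟩
    · exact Subrepresentation.toSubmodule_injective hc.inf_eq_bot
    · exact Subrepresentation.toSubmodule_injective hc.sup_eq_top

/-- Over a field of characteristic zero, two semisimple representations whose characters agree on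
a normal subgroup become equivalent on that subgroup. -/
theorem MatrixRep.exists_conj_of_trace_eq {Γ F : Type*} [Group Γ] [Field F] [CharZero F] {n : ℕ}
    {ρ₁ ρ₂ : Γ →* GL (Fin n) F} (hss₁ : MatrixRep.IsSemisimple ρ₁)
    (hss₂ : MatrixRep.IsSemisimple ρ₂) (N : Subgroup Γ) [N.Normal]
    (h : ∀ γ ∈ N, (ρ₁ γ : Matrix (Fin n) (Fin n) F).trace =
      (ρ₂ γ : Matrix (Fin n) (Fin n) F).trace) :
    ∃ g : GL (Fin n) F, ∀ γ ∈ N, ρ₂ γ = g * ρ₁ γ * g⁻¹ := by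
  let σ₁ : Representation F N (Fin n → F) := (toRepresentation ρ₁).comp N.subtype
  let σ₂ : Representation F N (Fin n → F) := (toRepresentation ρ₂).comp N.subtype
  have : IsSemisimpleModule F[N] σ₁.asModule :=
    Representation.isSemisimpleModule_comp_subtype _ N hss₁.isSemisimpleRepresentation
  have : IsSemisimpleModule F[N] σ₂.asModule :=
    Representation.isSemisimpleModule_comp_subtype _ N hss₂.isSemisimpleRepresentation
  have htr (r : F[N]) : LinearMap.trace F σ₁.asModule (Algebra.lsmul F F σ₁.asModule r) =
      LinearMap.trace F σ₂.asModule (Algebra.lsmul F F σ₂.asModule r) := by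
    have key : (LinearMap.trace F (Fin n → F)) ∘ₗ σ₁.asAlgebraHom.toLinearMap =
        (LinearMap.trace F (Fin n → F)) ∘ₗ σ₂.asAlgebraHom.toLinearMap := by
      refine MonoidAlgebra.lhom_ext' fun γ ↦ LinearMap.ext_ring ?_
      have h1 := h γ γ.2
      rw [← Matrix.trace_toLin'_eq, ← Matrix.trace_toLin'_eq] at h1
      simp only [LinearMap.comp_apply, MonoidAlgebra.lsingle_apply, AlgHom.toLinearMap_apply,
        Representation.asAlgebraHom_single_one]
      exact h1
    exact LinearMap.congr_fun key r
  obtain ⟨e⟩ := IsSemisimpleModule.nonempty_linearEquiv_of_trace_eq htr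
  let e' : (Fin n → F) ≃ₗ[F] (Fin n → F) :=
    σ₁.asModuleEquiv.symm.trans ((e.restrictScalars F).trans σ₂.asModuleEquiv)
  have he' (γ : N) (v : Fin n → F) : e' (σ₁ γ v) = σ₂ γ (e' v) := by
    have := e.map_smul (MonoidAlgebra.single γ 1) (σ₁.asModuleEquiv.symm v)
    rw [Representation.single_smul,
      Representation.single_smul, one_smul, one_smul] at this
    exact this
  let g : GL (Fin n) F := Matrix.GeneralLinearGroup.toLin.symm
    (LinearMap.GeneralLinearGroup.ofLinearEquiv e')
  have hg (v : Fin n → F) : (g : Matrix (Fin n) (Fin n) F).mulVec v = e' v := by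
    rw [← Matrix.mulVecLin_apply, ← Matrix.GeneralLinearGroup.coe_toLin,
      MulEquiv.apply_symm_apply]
    rfl
  refine ⟨g, fun γ hγ ↦ eq_mul_inv_of_mul_eq (Units.ext ?_)⟩
  refine Matrix.toLin'.injective (LinearMap.ext fun v ↦ ?_)
  have := (he' ⟨γ, hγ⟩ v).symm
  rw [← hg, ← hg] at this
  simpa [σ₁, σ₂, toRepresentation] using this

/-- If the `k`-th powers of the characters of two semisimple representations
`ρ₁, ρ₂ : Γ → GL_n(F)` over a field of characteristic zero agree for some `k ≥ 1`,
then `ρ₁` and `ρ₂` are potentially isomorphic: they are equivalent when restricted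
to some finite-index subgroup of `Γ`. -/
theorem potentially_isomorphic_of_char_pow_eq
    (Γ : Type*) [Group Γ] (F : Type*) [Field F] [CharZero F] (n : ℕ)
    (ρ₁ ρ₂ : Γ →* GL (Fin n) F)
    (hss₁ : MatrixRep.IsSemisimple ρ₁) (hss₂ : MatrixRep.IsSemisimple ρ₂)
    (k : ℕ) (hk : 0 < k)
    (hchar : ∀ γ : Γ, (ρ₁ γ : Matrix (Fin n) (Fin n) F).trace ^ k =
      (ρ₂ γ : Matrix (Fin n) (Fin n) F).trace ^ k) :
    ∃ Γ' : Subgroup Γ, Γ'.FiniteIndex ∧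
      ∃ g : GL (Fin n) F, ∀ γ ∈ Γ', ρ₂ γ = g * ρ₁ γ * g⁻¹ := by
  rcases eq_or_ne n 0 with rfl | hn
  · exact ⟨⊤, inferInstance, 1, fun γ _ ↦ Subsingleton.elim _ _⟩
  · have : NeZero n := ⟨hn⟩
    obtain ⟨Γ', hΓ', h⟩ := exists_finiteIndex_trace_eq ρ₁ ρ₂ hk hchar
    exact ⟨Γ'.normalCore, inferInstance, MatrixRep.exists_conj_of_trace_eq hss₁ hss₂ _
      fun γ hγ ↦ h γ (Γ'.normalCore_le hγ)⟩
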